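/- arXiv:1109.0875 — 7 statements merged into one kernel-verified Lean document; each statement's English description precedes it below -/
import Mathlib

section
/- Let R be a commutative ℝ-algebra, E an R-module, [·,·] : E → E → E an ℝ-bilinear bracket, and ρ : E → Derivation ℝ R R an additive map, satisfying (L1) [a,[b,c]] = [[a,b],c] + [b,[a,c]] for all a,b,c ∈ E and (L2) [a, f•b] = f•[a,b] + (ρ a f)•b for all a,b ∈ E, f ∈ R. If E is a faithful R-module (i.e. whenever f ∈ R satisfies f•x = 0 for all x ∈ E, then f = 0), then the anchor is bracket-preserving: ρ [a,b] = ⁅ρ a, ρ b⁆ (commutator of derivations) for all a,b ∈ E. (Axiom (L3) of a Leibniz algebroid is a consequence of (L1) and (L2).) -/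
/-- For a structure satisfying the Leibniz algebroid axioms (L1) and (L2),
over a commutative ℝ-algebra `R`, with `E` a faithful `R`-module, the anchor is
bracket-preserving (axiom (L3) follows from (L1) and (L2)). -/
theorem anchor_bracket_preserving
    {R : Type} [CommRing R] [Algebra ℝ R]
    {E : Type} [AddCommGroup E] [Module ℝ E] [Module R E] [IsScalarTower ℝ R E]
    (bk : E → E → E)
    (bk_add_left : ∀ a b c : E, bk (a + b) c = bk a c + bk b c)
    (bk_add_right : ∀ a b c : E, bk a (b + c) = bk a b + bk a c)
    (bk_smul_left : ∀ (r : ℝ) (a b : E), bk (r • a) b = r • bk a b)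
    (bk_smul_right : ∀ (r : ℝ) (a b : E), bk a (r • b) = r • bk a b)
    (ρ : E → Derivation ℝ R R)
    (ρ_add : ∀ a b : E, ρ (a + b) = ρ a + ρ b)
    (hL1 : ∀ a b c : E, bk a (bk b c) = bk (bk a b) c + bk b (bk a c))
    (hL2 : ∀ (a b : E) (f : R), bk a (f • b) = f • bk a b + (ρ a f) • b)
    (hfaithful : ∀ f : R, (∀ x : E, f • x = 0) → f = 0) :
    ∀ a b : E, ρ (bk a b) = ⁅ρ a, ρ b⁆ := by
  intro a b
  ext f
  rw [← sub_eq_zero, Derivation.commutator_apply]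
  refine hfaithful _ fun x => ?_
  have h := hL1 a b (f • x)
  simp only [hL2, bk_add_right] at h
  rw [hL1 a b x, smul_add] at h
  rw [sub_smul, sub_smul, ← sub_eq_zero.mpr h.symm]
  abel
end

section
/- For a conformal Courant algebroid datum over a commutative ℝ-algebra R satisfying the spanning condition, the E-connection ∇ on L is flat: for all a,b ∈ E and s ∈ L, ∇_a(∇_b s) − ∇_b(∇_a s) = ∇_{[a,b]} s. -/
/-- A conformal Courant algebroid datum over a commutative ℝ-algebra `R`:
a Leibniz algebroid datum `(E, bk, anchor)` together with an `R`-module `L`,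
a symmetric nondegenerate `R`-bilinear pairing, an `E`-connection `conn` on `L`
and an additive map `D : L → E` with `pair a (D s) = conn a s`, satisfying the
conformal Courant axioms (CC1) and (CC2). -/
structure ConformalCourantData (R : Type) [CommRing R] [Algebra ℝ R]
    (E : Type) [AddCommGroup E] [Module ℝ E] [Module R E] [IsScalarTower ℝ R E]
    (L : Type) [AddCommGroup L] [Module ℝ L] [Module R L] [IsScalarTower ℝ R L] :
    Type where
  bk : E → E → E
  anchor : E → Derivation ℝ R R
  pair : E → E → L
  conn : E → L → L
  D : L → E
  bk_add_left : ∀ a b c : E, bk (a + b) c = bk a c + bk b c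
  bk_add_right : ∀ a b c : E, bk a (b + c) = bk a b + bk a c
  bk_smul_left : ∀ (r : ℝ) (a b : E), bk (r • a) b = r • bk a b
  bk_smul_right : ∀ (r : ℝ) (a b : E), bk a (r • b) = r • bk a b
  anchor_add : ∀ a b : E, anchor (a + b) = anchor a + anchor b
  leibniz1 : ∀ a b c : E, bk a (bk b c) = bk (bk a b) c + bk b (bk a c)
  leibniz2 : ∀ (a b : E) (f : R), bk a (f • b) = f • bk a b + (anchor a f) • b
  leibniz3 : ∀ a b : E, anchor (bk a b) = ⁅anchor a, anchor b⁆
  pair_symm : ∀ a b : E, pair a b = pair b a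
  pair_add_left : ∀ a b c : E, pair (a + b) c = pair a c + pair b c
  pair_smul_left : ∀ (f : R) (a b : E), pair (f • a) b = f • pair a b
  pair_nondeg : ∀ a : E, (∀ b : E, pair a b = 0) → a = 0
  conn_add_left : ∀ (a b : E) (s : L), conn (a + b) s = conn a s + conn b s
  conn_add_right : ∀ (a : E) (s t : L), conn a (s + t) = conn a s + conn a t
  conn_smul_left : ∀ (f : R) (a : E) (s : L), conn (f • a) s = f • conn a s
  conn_leibniz : ∀ (a : E) (f : R) (s : L),
    conn a (f • s) = (anchor a f) • s + f • conn a s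
  D_add : ∀ s t : L, D (s + t) = D s + D t
  pair_D : ∀ (a : E) (s : L), pair a (D s) = conn a s
  cc1 : ∀ a b c : E, conn a (pair b c) = pair (bk a b) c + pair b (bk a c)
  cc2 : ∀ a b : E, bk a b + bk b a = D (pair a b)

/-- The spanning condition: the `R`-submodule of `L` generated by all pairings
`⟨a,b⟩` is all of `L`. -/
def ConformalCourantData.Spanning {R : Type} [CommRing R] [Algebra ℝ R]
    {E : Type} [AddCommGroup E] [Module ℝ E] [Module R E] [IsScalarTower ℝ R E]
    {L : Type} [AddCommGroup L] [Module ℝ L] [Module R L] [IsScalarTower ℝ R L]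
    (dat : ConformalCourantData R E L) : Prop :=
  Submodule.span R {x : L | ∃ a b : E, x = dat.pair a b} = ⊤

/-- Flatness of the connection on the pairing of two sections. -/
theorem ConformalCourantData.conn_flat_pair {R : Type} [CommRing R] [Algebra ℝ R]
    {E : Type} [AddCommGroup E] [Module ℝ E] [Module R E] [IsScalarTower ℝ R E]
    {L : Type} [AddCommGroup L] [Module ℝ L] [Module R L] [IsScalarTower ℝ R L]
    (dat : ConformalCourantData R E L) (a b c d : E) :
    dat.conn a (dat.conn b (dat.pair c d)) - dat.conn b (dat.conn a (dat.pair c d)) =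
      dat.conn (dat.bk a b) (dat.pair c d) := by
  have pair_add_right (x y z : E) : dat.pair x (y + z) = dat.pair x y + dat.pair x z := by
    rw [dat.pair_symm, dat.pair_add_left, dat.pair_symm y, dat.pair_symm z]
  simp only [dat.cc1, dat.conn_add_right]
  rw [dat.leibniz1 a b c, dat.leibniz1 a b d, dat.pair_add_left, pair_add_right]
  abel

/-- For a conformal Courant algebroid datum satisfying the spanning
condition, the `E`-connection `∇` on `L` is flat. -/
theorem conn_flat {R : Type} [CommRing R] [Algebra ℝ R]
    {E : Type} [AddCommGroup E] [Module ℝ E] [Module R E] [IsScalarTower ℝ R E]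
    {L : Type} [AddCommGroup L] [Module ℝ L] [Module R L] [IsScalarTower ℝ R L]
    (dat : ConformalCourantData R E L) (hspan : dat.Spanning) :
    ∀ (a b : E) (s : L),
      dat.conn a (dat.conn b s) - dat.conn b (dat.conn a s) = dat.conn (dat.bk a b) s := by
  intro a b s
  have hs : s ∈ Submodule.span R {x : L | ∃ a b : E, x = dat.pair a b} := by
    rw [show Submodule.span R {x : L | ∃ a b : E, x = dat.pair a b} = ⊤ from hspan]
    exact Submodule.mem_top
  have conn_zero (x : E) : dat.conn x 0 = 0 := by
    simpa using dat.conn_add_right x 0 0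
  induction hs using Submodule.span_induction with
  | mem x hx =>
    obtain ⟨c, d, rfl⟩ := hx
    exact dat.conn_flat_pair a b c d
  | zero => simp [conn_zero]
  | add x y _ _ hx hy =>
    simp only [dat.conn_add_right]
    rw [← hx, ← hy]
    abel
  | smul f x _ hx =>
    simp only [dat.conn_leibniz, dat.conn_add_right, dat.leibniz3, Derivation.commutator_apply]
    rw [← hx]
    module
end

section
/- For a conformal Courant algebroid datum over a commutative ℝ-algebra R satisfying the spanning condition, [D s, a] = 0 for all a ∈ E and s ∈ L. -/
namespace ConformalCourantData

variable {R : Type} [CommRing R] [Algebra ℝ R]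
  {E : Type} [AddCommGroup E] [Module ℝ E] [Module R E] [IsScalarTower ℝ R E]
  {L : Type} [AddCommGroup L] [Module ℝ L] [Module R L] [IsScalarTower ℝ R L]

lemma bk_zero_left (dat : ConformalCourantData R E L) (a : E) : dat.bk 0 a = 0 := by
  simpa using dat.bk_add_left 0 0 a

lemma D_zero (dat : ConformalCourantData R E L) : dat.D 0 = 0 := by
  simpa using dat.D_add 0 0

/-- The symmetric part of the bracket acts trivially from the left, by the Leibniz identity. -/
lemma bk_D_pair_left (dat : ConformalCourantData R E L) (a b c : E) :
    dat.bk (dat.D (dat.pair a b)) c = 0 := by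
  rw [← dat.cc2, dat.bk_add_left]
  have h : dat.bk (dat.bk a b) c + dat.bk b (dat.bk a c) +
      (dat.bk (dat.bk b a) c) = dat.bk b (dat.bk a c) := by
    rw [← dat.leibniz1 a b c, dat.leibniz1 b a c, add_comm]
  rwa [add_right_comm, add_eq_right] at h

end ConformalCourantData

/-- For a conformal Courant algebroid datum satisfying the spanning
condition, `[D s, a] = 0` for all `a ∈ E` and `s ∈ L`. -/
theorem bk_D_left_eq_zero {R : Type} [CommRing R] [Algebra ℝ R]
    {E : Type} [AddCommGroup E] [Module ℝ E] [Module R E] [IsScalarTower ℝ R E]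
    {L : Type} [AddCommGroup L] [Module ℝ L] [Module R L] [IsScalarTower ℝ R L]
    (dat : ConformalCourantData R E L) (hspan : dat.Spanning) :
    ∀ (a : E) (s : L), dat.bk (dat.D s) a = 0 := by
  intro a s
  have key : ∀ f : R, dat.bk (dat.D (f • s)) a = 0 := by
    have hs : s ∈ Submodule.span R {x : L | ∃ a b : E, x = dat.pair a b} :=
      hspan ▸ Submodule.mem_top
    induction hs using Submodule.span_induction with
    | mem x hx =>
      obtain ⟨b, c, rfl⟩ := hx
      intro f
      rw [← dat.pair_smul_left, dat.bk_D_pair_left]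
    | zero =>
      intro f
      rw [smul_zero, dat.D_zero, dat.bk_zero_left]
    | add x y _ _ hx hy =>
      intro f
      rw [smul_add, dat.D_add, dat.bk_add_left, hx, hy, add_zero]
    | smul g x _ hx =>
      intro f
      rw [smul_smul, hx]
  simpa using key 1
end

section
/- For a conformal Courant algebroid datum over a commutative ℝ-algebra R satisfying the spanning condition, [a, D s] = D(∇_a s) for all a ∈ E and s ∈ L. -/
/-- The identity `[a, D s] = D (∇_a s)` holds whenever `s` is a pairing `⟨b, c⟩`. -/
theorem ConformalCourantData.bk_D_pair {R : Type} [CommRing R] [Algebra ℝ R]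
    {E : Type} [AddCommGroup E] [Module ℝ E] [Module R E] [IsScalarTower ℝ R E]
    {L : Type} [AddCommGroup L] [Module ℝ L] [Module R L] [IsScalarTower ℝ R L]
    (dat : ConformalCourantData R E L) (a b c : E) :
    dat.bk a (dat.D (dat.pair b c)) = dat.D (dat.conn a (dat.pair b c)) := by
  rw [← dat.cc2, dat.bk_add_right, dat.cc1, dat.D_add, ← dat.cc2, ← dat.cc2,
    dat.leibniz1 a b c, dat.leibniz1 a c b]
  abel

/-- For a conformal Courant algebroid datum satisfying the spanning
condition, `[a, D s] = D (∇_a s)` for all `a ∈ E` and `s ∈ L`. -/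
theorem bk_D_right {R : Type} [CommRing R] [Algebra ℝ R]
    {E : Type} [AddCommGroup E] [Module ℝ E] [Module R E] [IsScalarTower ℝ R E]
    {L : Type} [AddCommGroup L] [Module ℝ L] [Module R L] [IsScalarTower ℝ R L]
    (dat : ConformalCourantData R E L) (hspan : dat.Spanning) :
    ∀ (a : E) (s : L), dat.bk a (dat.D s) = dat.D (dat.conn a s) := by
  intro a s
  have hs : s ∈ Submodule.span R {x : L | ∃ a b : E, x = dat.pair a b} :=
    Submodule.eq_top_iff'.mp hspan s
  induction hs using Submodule.closure_induction with
  | zero =>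
    have hD : dat.D 0 = 0 := by simpa using dat.D_add 0 0
    have hbk : dat.bk a 0 = 0 := by simpa using dat.bk_add_right a 0 0
    have hconn : dat.conn a 0 = 0 := by simpa using dat.conn_add_right a 0 0
    rw [hconn, hD, hbk]
  | add x y _ _ hx hy =>
    rw [dat.D_add, dat.bk_add_right, hx, hy, dat.conn_add_right, dat.D_add]
  | smul_mem f x hx =>
    obtain ⟨b, c, rfl⟩ := hx
    rw [← dat.pair_smul_left]
    exact dat.bk_D_pair a (f • b) c
end

section
/- For a conformal Courant algebroid datum over a commutative ℝ-algebra R satisfying the spanning condition, the connection ∇ annihilates symmetrized brackets: for all b,c ∈ E and s ∈ L, ∇_{[b,c] + [c,b]} s = 0; equivalently ∇_{D⟨b,c⟩} s = 0. (This is the key step in showing that for an exact conformal Courant algebroid, ∇_a v = 0 whenever ρ(a) = 0.) -/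
namespace ConformalCourantData

variable {R : Type} [CommRing R] [Algebra ℝ R]
  {E : Type} [AddCommGroup E] [Module ℝ E] [Module R E] [IsScalarTower ℝ R E]
  {L : Type} [AddCommGroup L] [Module ℝ L] [Module R L] [IsScalarTower ℝ R L]
  (dat : ConformalCourantData R E L)

theorem bk_symm_bracket_left (b c a : E) : dat.bk (dat.bk b c + dat.bk c b) a = 0 := by
  have h := dat.leibniz1 b c a
  rw [dat.leibniz1 c b a] at h
  rw [dat.bk_add_left]
  have h' : dat.bk b (dat.bk c a) + 0 =
      dat.bk b (dat.bk c a) + (dat.bk (dat.bk b c) a + dat.bk (dat.bk c b) a) := by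
    rw [add_zero]
    nth_rewrite 1 [h]
    abel
  exact (add_left_cancel h').symm

theorem anchor_symm_bracket (b c : E) : dat.anchor (dat.bk b c + dat.bk c b) = 0 := by
  rw [dat.anchor_add, dat.leibniz3, dat.leibniz3, ← lie_skew (dat.anchor b), neg_add_cancel]

theorem pair_zero_left (a : E) : dat.pair 0 a = 0 := by
  simpa using dat.pair_smul_left 0 0 a

theorem conn_zero_right (a : E) : dat.conn a 0 = 0 := by
  simpa using dat.conn_add_right a 0 0

theorem conn_symm_bracket (hspan : dat.Spanning) (b c : E) (s : L) :
    dat.conn (dat.bk b c + dat.bk c b) s = 0 := by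
  have hs : s ∈ Submodule.span R {x : L | ∃ a b : E, x = dat.pair a b} := by
    rw [show Submodule.span R {x : L | ∃ a b : E, x = dat.pair a b} = ⊤ from hspan]
    trivial
  induction hs using Submodule.span_induction with
  | mem x hx =>
    obtain ⟨p, q, rfl⟩ := hx
    rw [dat.cc1, bk_symm_bracket_left, bk_symm_bracket_left, dat.pair_symm p, pair_zero_left,
      pair_zero_left, add_zero]
  | zero => exact dat.conn_zero_right _
  | add x y _ _ hx hy => rw [dat.conn_add_right, hx, hy, add_zero]
  | smul f x _ hx =>
    rw [dat.conn_leibniz, anchor_symm_bracket, hx, Derivation.zero_apply, zero_smul, smul_zero,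
      add_zero]

end ConformalCourantData

/-- For a conformal Courant algebroid datum satisfying the spanning
condition, the connection annihilates symmetrized brackets:
`∇_{[b,c] + [c,b]} s = 0`, equivalently `∇_{D⟨b,c⟩} s = 0`. -/
theorem conn_symm_bracket_eq_zero {R : Type} [CommRing R] [Algebra ℝ R]
    {E : Type} [AddCommGroup E] [Module ℝ E] [Module R E] [IsScalarTower ℝ R E]
    {L : Type} [AddCommGroup L] [Module ℝ L] [Module R L] [IsScalarTower ℝ R L]
    (dat : ConformalCourantData R E L) (hspan : dat.Spanning) :
    ∀ (b c : E) (s : L), dat.conn (dat.bk b c + dat.bk c b) s = 0 ∧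
      dat.conn (dat.D (dat.pair b c)) s = 0 := by
  intro b c s
  refine ⟨dat.conn_symm_bracket hspan b c s, ?_⟩
  rw [← dat.cc2]
  exact dat.conn_symm_bracket hspan b c s
end

section
/- For a conformal Courant algebroid datum over a commutative ℝ-algebra R satisfying the spanning condition, the image of D on pairings is isotropic: for all a,b,c,d ∈ E, ⟨D⟨a,b⟩, D⟨c,d⟩⟩ = 0. (This is the algebraic content of the claim that the image of T*M⊗L in an exact conformal Courant algebroid is isotropic.) -/
namespace ConformalCourantData

variable {R : Type} [CommRing R] [Algebra ℝ R]
  {E : Type} [AddCommGroup E] [Module ℝ E] [Module R E] [IsScalarTower ℝ R E]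
  {L : Type} [AddCommGroup L] [Module ℝ L] [Module R L] [IsScalarTower ℝ R L]
  (dat : ConformalCourantData R E L)

theorem pair_zero_right (a : E) : dat.pair a 0 = 0 := by
  rw [dat.pair_symm, dat.pair_zero_left]

/-- The symmetric part of the bracket acts trivially from the left. -/
theorem bk_D_pair_s6 (a b c : E) : dat.bk (dat.D (dat.pair a b)) c = 0 := by
  rw [← dat.cc2, dat.bk_add_left]
  have h := dat.leibniz1 a b c
  rw [dat.leibniz1 b a c, ← add_assoc] at h
  exact right_eq_add.mp h

theorem conn_D_pair (a b c e : E) : dat.conn (dat.D (dat.pair a b)) (dat.pair c e) = 0 := by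
  rw [dat.cc1, bk_D_pair_s6, bk_D_pair_s6, pair_zero_left, pair_zero_right, add_zero]

end ConformalCourantData

/-- For a conformal Courant algebroid datum satisfying the spanning
condition, the image of `D` on pairings is isotropic: `⟨D⟨a,b⟩, D⟨c,e⟩⟩ = 0`. -/
theorem D_pair_isotropic {R : Type} [CommRing R] [Algebra ℝ R]
    {E : Type} [AddCommGroup E] [Module ℝ E] [Module R E] [IsScalarTower ℝ R E]
    {L : Type} [AddCommGroup L] [Module ℝ L] [Module R L] [IsScalarTower ℝ R L]
    (dat : ConformalCourantData R E L) (hspan : dat.Spanning) :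
    ∀ a b c e : E, dat.pair (dat.D (dat.pair a b)) (dat.D (dat.pair c e)) = 0 := by
  intro a b c e
  rw [dat.pair_D, dat.conn_D_pair]
end

section
/- Compatibility of T-duality with twisted spin structure obstructions: let R be a commutative ring in which 2 = 0 (modeling the mod-2 cohomology ring H*(M, ℤ₂)). Let u, ξ, ε, α, w₂ ∈ R and t ∈ ℤ. Define the obstructions O₁ := (u + ξ) + t•ε and O₂ := w₂ + ((t*(t+1))/2)•(ε*ε) + α*ε, and the T-dual obstructions Ô₁ := ((u + ξ) + ε) + (t−1)•ε and Ô₂ := (w₂ + u*ε) + (((t−1)*t)/2)•(ε*ε) + (α + ξ)*ε (here n•x denotes the ℤ-scalar multiple, and t(t±1)/2 is the integer binomial value). Then Ô₁ = O₁ and Ô₂ = O₂ + ε*O₁; consequently O₁ = 0 and O₂ = 0 if and only if Ô₁ = 0 and Ô₂ = 0. -/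
/-- Compatibility of T-duality with twisted spin structure
obstructions: in a commutative ring with `2 = 0` (modeling `H*(M, ℤ₂)`), with
`O₁ = (u + ξ) + t•ε`, `O₂ = w₂ + (t(t+1)/2)•ε² + α·ε` and T-dual obstructions
`Ô₁ = ((u + ξ) + ε) + (t−1)•ε`, `Ô₂ = (w₂ + u·ε) + ((t−1)t/2)•ε² + (α + ξ)·ε`,
one has `Ô₁ = O₁` and `Ô₂ = O₂ + ε·O₁`; consequently `O₁ = O₂ = 0` iff
`Ô₁ = Ô₂ = 0`. -/
theorem tduality_spin_obstructions {R : Type} [CommRing R] (h2 : (2 : R) = 0)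
    (u ξ ε α w₂ : R) (t : ℤ) :
    (((u + ξ) + ε) + (t - 1) • ε = (u + ξ) + t • ε) ∧
    ((w₂ + u * ε) + ((t - 1) * t / 2) • (ε * ε) + (α + ξ) * ε
        = (w₂ + (t * (t + 1) / 2) • (ε * ε) + α * ε) + ε * ((u + ξ) + t • ε)) ∧
    ((((u + ξ) + t • ε = 0) ∧ (w₂ + (t * (t + 1) / 2) • (ε * ε) + α * ε = 0)) ↔
      ((((u + ξ) + ε) + (t - 1) • ε = 0) ∧
        ((w₂ + u * ε) + ((t - 1) * t / 2) • (ε * ε) + (α + ξ) * ε = 0))) := by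
  have hdiv : t * (t + 1) / 2 = (t - 1) * t / 2 + t := by
    rw [show t * (t + 1) = (t - 1) * t + t * 2 by ring]
    exact Int.add_mul_ediv_right _ _ two_ne_zero
  have h₁ : ((u + ξ) + ε) + (t - 1) • ε = (u + ξ) + t • ε := by
    rw [sub_smul, one_smul]
    abel
  have h₂ : (w₂ + u * ε) + ((t - 1) * t / 2) • (ε * ε) + (α + ξ) * ε
      = (w₂ + (t * (t + 1) / 2) • (ε * ε) + α * ε) + ε * ((u + ξ) + t • ε) := by
    rw [hdiv]
    simp only [zsmul_eq_mul, Int.cast_add]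
    linear_combination (-(t : R) * ε * ε) * h2
  refine ⟨h₁, h₂, ?_⟩
  rw [h₁, h₂]
  refine and_congr_right fun h => ?_
  rw [h, mul_zero, add_zero]
end
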